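/- Assume γ ≥ 3. Let (ρ̄, Ē) be a C¹ solution of the reduced system on [r0, r0 + R1] with ρ̄(r) > 0, with M̄1²(r) < 1 and r Ē(r) > 0 for all r ∈ [r0, r0 + R1]. Then the squared angular Mach number is strictly decreasing: (M̄2²)'(r) < 0 for all r ∈ [r0, r0 + R1]. Consequently, if M̄2²(r0) > 1, then by continuity there is a constant R0 ∈ (0, R1] such that M̄2²(r) > 1, and hence M̄1²(r) + M̄2²(r) > 1, for all r ∈ [r0, r0 + R0]. -/

import Mathlib

open Real Set

/-- Radial velocity `Ū1(r) = J1/(r ρ̄(r))` of the background flow. -/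
noncomputable def Ubar1 (J1 : ℝ) (ρ : ℝ → ℝ) (r : ℝ) : ℝ := J1 / (r * ρ r)

/-- Angular velocity `Ū2(r) = J2/r` of the background flow. -/
noncomputable def Ubar2 (J2 r : ℝ) : ℝ := J2 / r

/-- Squared sound speed `c̄²(r) = γ e^{S0} ρ̄(r)^{γ−1}`. -/
noncomputable def csq (γ S0 : ℝ) (ρ : ℝ → ℝ) (r : ℝ) : ℝ :=
  γ * Real.exp S0 * ρ r ^ (γ - 1)

/-- Squared radial Mach number `M̄1²(r) = Ū1²(r)/c̄²(r)`. -/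
noncomputable def M1sq (γ S0 J1 : ℝ) (ρ : ℝ → ℝ) (r : ℝ) : ℝ :=
  (Ubar1 J1 ρ r) ^ 2 / csq γ S0 ρ r

/-- Squared angular Mach number `M̄2²(r) = Ū2²(r)/c̄²(r)`. -/
noncomputable def M2sq (γ S0 J2 : ℝ) (ρ : ℝ → ℝ) (r : ℝ) : ℝ :=
  (Ubar2 J2 r) ^ 2 / csq γ S0 ρ r

/-- The reduced ODE system for `(ρ̄, Ē)` on the interval `[r0, r1]`. -/
def ReducedSystem (γ S0 b0 J1 J2 r0 r1 : ℝ) (ρ E : ℝ → ℝ) : Prop :=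
  ContDiffOn ℝ 1 ρ (Icc r0 r1) ∧ ContDiffOn ℝ 1 E (Icc r0 r1) ∧
  (∀ r ∈ Icc r0 r1,
    derivWithin ρ (Icc r0 r1) r =
      ρ r * ((Ubar1 J1 ρ r) ^ 2 + (Ubar2 J2 r) ^ 2 + r * E r)
        / (r * (csq γ S0 ρ r - (Ubar1 J1 ρ r) ^ 2))) ∧
  (∀ r ∈ Icc r0 r1, derivWithin (fun s => s * E s) (Icc r0 r1) r = r * (ρ r - b0))

theorem csq_pos {γ S0 : ℝ} {ρ : ℝ → ℝ} {r : ℝ} (hγ : 0 < γ) (hρ : 0 < ρ r) :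
    0 < csq γ S0 ρ r :=
  mul_pos (mul_pos hγ (Real.exp_pos S0)) (Real.rpow_pos_of_pos hρ _)

theorem hasDerivWithinAt_csq {γ S0 ρ' r : ℝ} {ρ : ℝ → ℝ} {s : Set ℝ}
    (h : HasDerivWithinAt ρ ρ' s r) (hρ : 0 < ρ r) :
    HasDerivWithinAt (csq γ S0 ρ) ((γ - 1) * csq γ S0 ρ r * (ρ' / ρ r)) s r := by
  refine ((h.rpow_const (p := γ - 1) (Or.inl hρ.ne')).const_mul
    (γ * Real.exp S0)).congr_deriv ?_
  rw [Real.rpow_sub_one hρ.ne', csq]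
  ring

/-- Logarithmic differentiation of the squared angular Mach number. -/
theorem hasDerivWithinAt_M2sq {γ S0 J2 ρ' r : ℝ} {ρ : ℝ → ℝ} {s : Set ℝ}
    (h : HasDerivWithinAt ρ ρ' s r) (hγ : 0 < γ) (hρ : 0 < ρ r) (hr : r ≠ 0) :
    HasDerivWithinAt (M2sq γ S0 J2 ρ)
      (-(M2sq γ S0 J2 ρ r * (2 / r + (γ - 1) * (ρ' / ρ r)))) s r := by
  have hc : csq γ S0 ρ r ≠ 0 := (csq_pos hγ hρ).ne'
  have hU : HasDerivWithinAt (fun x => Ubar2 J2 x ^ 2) (-(2 * J2 ^ 2 / r ^ 3)) s r := by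
    refine ((((hasDerivAt_id r).fun_inv hr).const_mul J2).fun_pow 2).hasDerivWithinAt.congr_deriv ?_
    simp only [id]
    field_simp
    simp
    field_simp
  refine (hU.fun_div (hasDerivWithinAt_csq h hρ) hc).congr_deriv ?_
  simp only [M2sq, Ubar2]
  have := hρ.ne'
  field_simp
  ring

/-- In the subsonic-radial regime with `r Ē > 0` the density is increasing. -/
theorem ReducedSystem.derivWithin_pos {γ S0 b0 J1 J2 r0 r1 r : ℝ} {ρ E : ℝ → ℝ}
    (hsol : ReducedSystem γ S0 b0 J1 J2 r0 r1 ρ E) (hr : r ∈ Icc r0 r1) (hr0 : 0 < r)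
    (hγ : 0 < γ) (hρ : 0 < ρ r) (hM1 : M1sq γ S0 J1 ρ r < 1) (hE : 0 < r * E r) :
    0 < derivWithin ρ (Icc r0 r1) r := by
  rw [hsol.2.2.1 r hr]
  have hsub : 0 < csq γ S0 ρ r - Ubar1 J1 ρ r ^ 2 :=
    sub_pos.2 ((div_lt_one (csq_pos hγ hρ)).1 hM1)
  positivity

/-- Assume `γ ≥ 3`. For a `C¹` solution of the reduced system on `[r0, r0 + R1]` with
`ρ̄ > 0`, `M̄1² < 1` and `r Ē > 0`, the squared angular Mach number is strictly
decreasing: `(M̄2²)' < 0`. Consequently, if `M̄2²(r0) > 1`, then there is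
`R0 ∈ (0, R1]` such that `M̄2² > 1`, hence `M̄1² + M̄2² > 1`, on `[r0, r0 + R0]`. -/
theorem M2sq_strictly_decreasing_supersonic
    (γ r0 b0 J1 J2 S0 R1 : ℝ)
    (hγ : 3 ≤ γ) (hr0 : 0 < r0) (hR1 : 0 < R1) (hb0 : 0 < b0)
    (hJ1 : 0 < J1) (hJ2 : J2 ≠ 0) (hS0 : 0 < S0)
    (ρ E : ℝ → ℝ)
    (hsol : ReducedSystem γ S0 b0 J1 J2 r0 (r0 + R1) ρ E)
    (hρpos : ∀ r ∈ Icc r0 (r0 + R1), 0 < ρ r)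
    (hM1 : ∀ r ∈ Icc r0 (r0 + R1), M1sq γ S0 J1 ρ r < 1)
    (hrE : ∀ r ∈ Icc r0 (r0 + R1), 0 < r * E r) :
    (∀ r ∈ Icc r0 (r0 + R1),
      derivWithin (fun s => M2sq γ S0 J2 ρ s) (Icc r0 (r0 + R1)) r < 0) ∧
    (1 < M2sq γ S0 J2 ρ r0 →
      ∃ R0, 0 < R0 ∧ R0 ≤ R1 ∧ ∀ r ∈ Icc r0 (r0 + R0),
        1 < M2sq γ S0 J2 ρ r ∧ 1 < M1sq γ S0 J1 ρ r + M2sq γ S0 J2 ρ r) := by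
  have hγ0 : 0 < γ := by linarith
  have hpos : ∀ r ∈ Icc r0 (r0 + R1), 0 < r := fun r hr => hr0.trans_le hr.1
  have hderiv : ∀ r ∈ Icc r0 (r0 + R1), HasDerivWithinAt (M2sq γ S0 J2 ρ) _
      (Icc r0 (r0 + R1)) r := fun r hr =>
    hasDerivWithinAt_M2sq ((hsol.1.differentiableOn one_ne_zero) r hr).hasDerivWithinAt
      hγ0 (hρpos r hr) (hpos r hr).ne'
  refine ⟨fun r hr => ?_, fun h1 => ?_⟩
  · have hr' := hpos r hr
    have hρ := hρpos r hr
    rw [(hderiv r hr).derivWithin (uniqueDiffOn_Icc (by linarith) r hr), neg_lt_zero]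
    have hρ' := hsol.derivWithin_pos hr hr' hγ0 hρ (hM1 r hr) (hrE r hr)
    have hM2 : 0 < M2sq γ S0 J2 ρ r :=
      div_pos (sq_pos_of_ne_zero (div_ne_zero hJ2 hr'.ne')) (csq_pos hγ0 hρ)
    have hγ1 : 0 < γ - 1 := by linarith
    positivity
  · have hmem : r0 ∈ Icc r0 (r0 + R1) := ⟨le_rfl, by linarith⟩
    have hev := (hderiv r0 hmem).continuousWithinAt.eventually (lt_mem_nhds h1)
    obtain ⟨ε, hε, hball⟩ := Metric.mem_nhdsWithin_iff.1 hev
    refine ⟨min R1 (ε / 2), lt_min hR1 (half_pos hε), min_le_left _ _, fun r hr => ?_⟩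
    have hrR : r ≤ r0 + R1 := hr.2.trans (by gcongr; exact min_le_left _ _)
    have hrε : r ≤ r0 + ε / 2 := hr.2.trans (by gcongr; exact min_le_right _ _)
    have hI : r ∈ Icc r0 (r0 + R1) := ⟨hr.1, hrR⟩
    have hM2 : 1 < M2sq γ S0 J2 ρ r := hball ⟨by
      rw [Metric.mem_ball, Real.dist_eq, abs_of_nonneg (sub_nonneg.2 hr.1)]
      linarith, hI⟩
    have hM1' : 0 ≤ M1sq γ S0 J1 ρ r :=
      div_nonneg (sq_nonneg _) (csq_pos hγ0 (hρpos r hI)).le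
    exact ⟨hM2, by linarith⟩
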